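/- arXiv:2405.20893 — 7 statements merged into one kernel-verified Lean document; each statement's English description precedes it below -/
import Mathlib

section
/- Let h be a Lie algebra over a field K. Then h is perfect if and only if the following transitivity property holds: for every Lie algebra g over K (in the same universe as h), every injective Lie algebra homomorphism f : h → g, and every Lie subalgebra k of g containing the range of f, if the range of f is an ideal of k (⁅k, range f⁆ ⊆ range f) and k is an ideal of g (⁅g, k⁆ ⊆ k), then the range of f is an ideal of g (⁅g, range f⁆ ⊆ range f). -/
/-- If the image of `f` is an ideal of an ideal `k`, then bracketing with any element of the
ambient algebra sends the image of the derived ideal into the image of `f`. -/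
theorem LieHom.lie_apply_mem_range_of_mem_derived {K h g : Type*} [CommRing K]
    [LieRing h] [LieAlgebra K h] [LieRing g] [LieAlgebra K g] (f : h →ₗ⁅K⁆ g)
    (k : LieSubalgebra K g) (hle : f.range ≤ k)
    (hk : ∀ x ∈ k, ∀ y ∈ f.range, ⁅x, y⁆ ∈ f.range) (hg : ∀ x : g, ∀ y ∈ k, ⁅x, y⁆ ∈ k)
    (x : g) {z : h} (hz : z ∈ ⁅(⊤ : LieIdeal K h), (⊤ : LieIdeal K h)⁆) :
    ⁅x, f z⁆ ∈ f.range := by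
  have hrange (a : h) : f a ∈ f.range := f.mem_range_self a
  rw [← LieSubmodule.mem_toSubmodule, LieSubmodule.lieIdeal_oper_eq_linear_span'] at hz
  induction hz using Submodule.span_induction with
  | mem z hz =>
    obtain ⟨a, -, b, -, rfl⟩ := hz
    rw [LieHom.map_lie, leibniz_lie]
    refine add_mem (hk _ (hg x _ (hle (hrange a))) _ (hrange b)) ?_
    rw [← lie_skew]
    exact neg_mem (hk _ (hg x _ (hle (hrange b))) _ (hrange a))
  | zero => simp
  | add a b _ _ ha hb =>
    rw [map_add, lie_add]
    exact add_mem ha hb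
  | smul t a _ ha =>
    rw [map_smul, lie_smul]
    exact f.range.smul_mem t ha

/-- A Lie algebra over a field that is not perfect has a nonzero character. -/
theorem LieAlgebra.exists_lieCharacter_ne_zero {K h : Type*} [Field K] [LieRing h]
    [LieAlgebra K h] (hh : ⁅(⊤ : LieIdeal K h), (⊤ : LieIdeal K h)⁆ ≠ ⊤) :
    ∃ χ : LieAlgebra.LieCharacter K h, ∃ v : h, χ v ≠ 0 := by
  have hlt : (⁅(⊤ : LieIdeal K h), (⊤ : LieIdeal K h)⁆ : LieIdeal K h).toSubmodule < ⊤ :=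
    lt_top_iff_ne_top.2 fun e => hh ((LieSubmodule.toSubmodule_eq_top _).1 e)
  obtain ⟨φ, hφ, hker⟩ := Submodule.exists_le_ker_of_lt_top _ hlt
  have hlie (x y : h) : φ ⁅x, y⁆ = 0 :=
    hker (LieSubmodule.lie_mem_lie (LieSubmodule.mem_top x) (LieSubmodule.mem_top y))
  obtain ⟨v, hv⟩ := DFunLike.ne_iff.1 hφ
  let _ : LieRing K := LieRing.ofAssociativeRing
  let χ : LieAlgebra.LieCharacter K h :=
    { φ with map_lie' := fun {x y} => (hlie x y).trans (by simp [Ring.lie_def, mul_comm]) }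
  exact ⟨χ, v, hv⟩

/-- The semidirect product of `h × h₀` by `h₀`, where `h₀` is `h` with zero bracket and
`e : h₀` acts by the derivation `(x, a) ↦ (0, (χ e * χ x) • v)`. -/
@[ext] structure LieAlgebra.LieCharacter.ShearExtension {K h : Type*} [CommRing K]
    [LieRing h] [LieAlgebra K h] (χ : LieAlgebra.LieCharacter K h) (v : h) where
  /-- The component in `h`. -/
  base : h
  /-- The component in the central copy of `h₀`. -/
  central : h
  /-- The component in the acting copy of `h₀`. -/
  acting : h

namespace LieAlgebra.LieCharacter.ShearExtension

variable {K h : Type*} [CommRing K] [LieRing h] [LieAlgebra K h]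
  (χ : LieAlgebra.LieCharacter K h) (v : h)

/-- The underlying product of three copies of `h`. -/
def equivProd : ShearExtension χ v ≃ h × h × h where
  toFun x := (x.base, x.central, x.acting)
  invFun x := ⟨x.1, x.2.1, x.2.2⟩
  left_inv _ := rfl
  right_inv _ := rfl

instance : AddCommGroup (ShearExtension χ v) := (equivProd χ v).addCommGroup

instance : Module K (ShearExtension χ v) := (equivProd χ v).module K

instance : Bracket (ShearExtension χ v) (ShearExtension χ v) where
  bracket x y :=
    ⟨⁅x.base, y.base⁆, (χ x.acting * χ y.base - χ y.acting * χ x.base) • v, 0⟩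

variable {χ v}

@[simp] lemma zero_eq : (0 : ShearExtension χ v) = ⟨0, 0, 0⟩ := rfl

@[simp] lemma add_eq (x y : ShearExtension χ v) :
    x + y = ⟨x.base + y.base, x.central + y.central, x.acting + y.acting⟩ := rfl

@[simp] lemma smul_eq (t : K) (x : ShearExtension χ v) :
    t • x = ⟨t • x.base, t • x.central, t • x.acting⟩ := rfl

@[simp] lemma lie_eq (x y : ShearExtension χ v) :
    ⁅x, y⁆ = ⟨⁅x.base, y.base⁆, (χ x.acting * χ y.base - χ y.acting * χ x.base) • v, 0⟩ :=
  rfl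

instance : LieRing (ShearExtension χ v) where
  add_lie x y z := by
    ext <;> simp only [lie_eq, add_eq, add_lie, map_add, ← add_smul, add_zero]
    congr 1; ring
  lie_add x y z := by
    ext <;> simp only [lie_eq, add_eq, lie_add, map_add, ← add_smul, add_zero]
    congr 1; ring
  lie_self x := by simp
  leibniz_lie x y z := by
    ext <;> simp

instance : LieAlgebra K (ShearExtension χ v) where
  lie_smul t x y := by
    ext <;> simp only [lie_eq, smul_eq, lie_smul, map_smul, smul_smul, smul_zero, smul_eq_mul]
    congr 1; ring

variable (χ v)

/-- The inclusion of `h` as the first component. -/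
def inl : h →ₗ⁅K⁆ ShearExtension χ v where
  toFun x := ⟨x, 0, 0⟩
  map_add' _ _ := by simp
  map_smul' _ _ := by simp
  map_lie' := by simp

@[simp] lemma inl_apply (x : h) : inl χ v x = ⟨x, 0, 0⟩ := rfl

lemma inl_injective : Function.Injective (inl χ v) := fun _ _ hxy =>
  congrArg base hxy

/-- The elements with zero acting component. -/
def actingKer : LieSubalgebra K (ShearExtension χ v) where
  carrier := {x | x.acting = 0}
  zero_mem' := by simp
  add_mem' hx hy := by simp_all
  smul_mem' _ _ hx := by simp_all
  lie_mem' _ _ := by simp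

@[simp] lemma mem_actingKer {x : ShearExtension χ v} :
    x ∈ actingKer χ v ↔ x.acting = 0 := Iff.rfl

end LieAlgebra.LieCharacter.ShearExtension

/-- A Lie algebra `h` is perfect iff whenever `h` embeds into a Lie algebra `g` with image an
ideal of a Lie subalgebra `k` that is itself an ideal of `g`, the image of `h` is an ideal
of `g`. -/
theorem perfect_iff_transitive {K : Type*} [Field K]
    (h : Type u) [LieRing h] [LieAlgebra K h] :
    ⁅(⊤ : LieIdeal K h), (⊤ : LieIdeal K h)⁆ = ⊤ ↔
    ∀ (g : Type u) (_ : LieRing g) (_ : LieAlgebra K g) (f : h →ₗ⁅K⁆ g),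
      Function.Injective f →
      ∀ k : LieSubalgebra K g, f.range ≤ k →
        (∀ x ∈ k, ∀ y ∈ f.range, ⁅x, y⁆ ∈ f.range) →
        (∀ x : g, ∀ y ∈ k, ⁅x, y⁆ ∈ k) →
        (∀ x : g, ∀ y ∈ f.range, ⁅x, y⁆ ∈ f.range) := by
  constructor
  · rintro hh g _ _ f - k hle hk hg x _ ⟨z, rfl⟩
    exact f.lie_apply_mem_range_of_mem_derived k hle hk hg x (by simp [hh])
  · intro H
    by_contra hh
    obtain ⟨χ, v, hv⟩ := LieAlgebra.exists_lieCharacter_ne_zero hh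
    let f := LieAlgebra.LieCharacter.ShearExtension.inl χ v
    obtain ⟨z, hz⟩ := H (χ.ShearExtension v) inferInstance inferInstance f
      (LieAlgebra.LieCharacter.ShearExtension.inl_injective χ v)
      (LieAlgebra.LieCharacter.ShearExtension.actingKer χ v)
      (by rintro _ ⟨x, rfl⟩; simp [f])
      (by
        rintro x hx _ ⟨y, rfl⟩
        refine ⟨⁅x.base, y⁆, ?_⟩
        have hx : x.acting = 0 := hx
        simp [f, hx])
      (by intro x y _; simp)
      ⟨0, 0, v⟩ (f v) (f.mem_range_self v)
    have hcentral : 0 = (χ v * χ v) • v := by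
      simpa [f] using congrArg LieAlgebra.LieCharacter.ShearExtension.central hz
    have := congrArg χ hcentral
    simp [hv] at this
end

section
/- Let g be a finite-dimensional Lie algebra over a field of characteristic zero and let h be a Lie subalgebra of g that is a subideal of g, i.e. there is a finite chain of Lie subalgebras h = l₀ ⊴ l₁ ⊴ ⋯ ⊴ lₙ = g, each an ideal of the next. Then the radical of h (as a Lie algebra in its own right) corresponds, under the inclusion h ↪ g, to the intersection of the radical of g with h: r_h = r_g ∩ h. -/
/-- `a` is an ideal of `b` (for Lie subalgebras `a ≤ b` of `g`). -/
def LieSubalgebra.IsIdealOf {K : Type*} [Field K] {g : Type*} [LieRing g] [LieAlgebra K g]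
    (a b : LieSubalgebra K g) : Prop :=
  a ≤ b ∧ ∀ x ∈ b, ∀ y ∈ a, ⁅x, y⁆ ∈ a

namespace LieAlgebra

variable {K L M : Type*} [Field K] [LieRing L] [LieAlgebra K L] [LieRing M] [LieAlgebra K M]

/-- An ideal whose derived ideal is solvable is solvable. -/
theorem isSolvable_of_isSolvable_lie_self (I : LieIdeal K L)
    (h : IsSolvable (⁅I, I⁆ : LieIdeal K L)) : IsSolvable I := by
  obtain ⟨k, hk⟩ := (isSolvable_iff K (L := (⁅I, I⁆ : LieIdeal K L))).mp h
  rw [LieIdeal.derivedSeries_eq_bot_iff] at hk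
  refine IsSolvable.mk (R := K) (k := k + 1) ?_
  rw [LieIdeal.derivedSeries_eq_bot_iff, derivedSeriesOfIdeal_add]
  exact hk

/-- The quotient map of a Lie algebra by an ideal, as a homomorphism of Lie algebras. -/
def quotientHom (I : LieIdeal K L) : L →ₗ⁅K⁆ L ⧸ I :=
  { (LieSubmodule.Quotient.mk' I : L →ₗ[K] L ⧸ I) with
    map_lie' := fun {x y} => LieSubmodule.Quotient.mk_bracket I x y }

theorem quotientHom_eq_zero {I : LieIdeal K L} {x : L} : quotientHom I x = 0 ↔ x ∈ I :=
  LieSubmodule.Quotient.mk_eq_zero I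

theorem quotientHom_surjective (I : LieIdeal K L) : Function.Surjective (quotientHom I) :=
  LieSubmodule.Quotient.surjective_mk' I

/-- The quotient of a Lie algebra by its radical has trivial radical. -/
theorem hasTrivialRadical_quotient_radical [IsNoetherian K L] :
    HasTrivialRadical K (L ⧸ radical K L) := by
  rw [hasTrivialRadical_iff_no_abelian_ideals]
  intro N hN
  have hlie : ⁅N, N⁆ = ⊥ := (LieSubmodule.lie_abelian_iff_lie_self_eq_bot N).mp hN
  let f := quotientHom (radical K L)
  let P : LieIdeal K L := N.comap f
  have hP : ⁅P, P⁆ ≤ radical K L := by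
    rw [LieSubmodule.lieIdeal_oper_eq_span, LieSubmodule.lieSpan_le]
    rintro _ ⟨⟨x, hx⟩, ⟨y, hy⟩, rfl⟩
    refine quotientHom_eq_zero.mp ?_
    have : ⁅f x, f y⁆ ∈ ⁅N, N⁆ :=
      LieSubmodule.lie_mem_lie (LieIdeal.mem_comap.mp hx) (LieIdeal.mem_comap.mp hy)
    rw [hlie] at this
    simpa using this
  have hPr : P ≤ radical K L := by
    rw [← LieIdeal.solvable_iff_le_radical] at hP ⊢
    exact isSolvable_of_isSolvable_lie_self P hP
  rw [eq_bot_iff]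
  intro y hy
  obtain ⟨x, rfl⟩ := quotientHom_surjective _ y
  exact (LieSubmodule.mem_bot _).mpr (quotientHom_eq_zero.mpr (hPr (LieIdeal.mem_comap.mpr hy)))

/-- In a Lie algebra with nondegenerate Killing form, a subspace of an ideal `J` that is stable
under `J` is stable under the whole Lie algebra. -/
theorem lie_mem_of_le_of_forall_lie_mem [FiniteDimensional K L] [IsKilling K L] (J : LieIdeal K L)
    (A : Submodule K L) (hAJ : A ≤ J.toSubmodule) (hA : ∀ x ∈ J, ∀ y ∈ A, ⁅x, y⁆ ∈ A)
    (x : L) {y : L} (hy : y ∈ A) : ⁅x, y⁆ ∈ A := by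
  have hc := J.isCompl_killingCompl
  obtain ⟨u, hu, v, hv, rfl⟩ : ∃ u ∈ J, ∃ v ∈ J.killingCompl, u + v = x := by
    rw [← LieSubmodule.mem_sup, hc.sup_eq_top]
    exact LieSubmodule.mem_top x
  have hvy : ⁅v, y⁆ = 0 := by
    have : ⁅v, y⁆ ∈ J ⊓ J.killingCompl :=
      ⟨lie_mem_right K L J v y (hAJ hy), lie_mem_left K L J.killingCompl v y hv⟩
    simpa [hc.inf_eq_bot] using this
  rw [add_lie, hvy, add_zero]
  exact hA u hu y hy

/-- A homomorphism whose range is an ideal of a Lie algebra with trivial radical kills the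
radical of its source. -/
theorem map_eq_zero_of_mem_radical [CharZero K] [FiniteDimensional K L] [FiniteDimensional K M]
    [HasTrivialRadical K M] (f : L →ₗ⁅K⁆ M) (hf : ∀ (x : M) (y : L), ∃ z, f z = ⁅x, f y⁆) {y : L}
    (hy : y ∈ radical K L) : f y = 0 := by
  let J : LieIdeal K M :=
    { LinearMap.range (f : L →ₗ[K] M) with
      lie_mem := by
        rintro x _ ⟨y, rfl⟩
        exact hf x y }
  let A : LieIdeal K M :=
    { (radical K L).toSubmodule.map (f : L →ₗ[K] M) with
      lie_mem := by
        intro x m hm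
        refine lie_mem_of_le_of_forall_lie_mem J _ LinearMap.map_le_range ?_ x hm
        rintro _ ⟨u, rfl⟩ _ ⟨v, hv, rfl⟩
        exact ⟨⁅u, v⁆, lie_mem_right K L _ u v hv, f.map_lie u v⟩ }
  let g : radical K L →ₗ⁅K⁆ A :=
    { ((f : L →ₗ[K] M).comp (radical K L).toSubmodule.subtype).codRestrict A.toSubmodule
        fun v => ⟨v, v.2, rfl⟩ with
      map_lie' := by
        intro u v
        exact Subtype.ext (f.map_lie u v) }
  have hg : Function.Surjective g := by
    rintro ⟨_, v, hv, rfl⟩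
    exact ⟨⟨v, hv⟩, rfl⟩
  have : IsSolvable A := hg.lieAlgebra_isSolvable
  have hfy : f y ∈ A := ⟨y, hy, rfl⟩
  rwa [HasTrivialRadical.eq_bot_of_isSolvable A, LieSubmodule.mem_bot] at hfy

/-- A homomorphism whose range is an ideal maps the radical into the radical. -/
theorem map_mem_radical [CharZero K] [FiniteDimensional K L] [FiniteDimensional K M]
    (f : L →ₗ⁅K⁆ M) (hf : ∀ (x : M) (y : L), ∃ z, f z = ⁅x, f y⁆) {y : L}
    (hy : y ∈ radical K L) : f y ∈ radical K M := by
  have := hasTrivialRadical_quotient_radical (K := K) (L := M)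
  refine quotientHom_eq_zero.mp
    (map_eq_zero_of_mem_radical ((quotientHom _).comp f) (fun x y => ?_) hy)
  obtain ⟨x, rfl⟩ := quotientHom_surjective _ x
  obtain ⟨z, hz⟩ := hf x y
  exact ⟨z, by simp [hz]⟩

/-- Elements of the radical that come from the source of an injective homomorphism come from the
radical of the source. -/
theorem mem_radical_of_map_mem [IsNoetherian K M] (f : L →ₗ⁅K⁆ M)
    (hf : Function.Injective f) {x : L} (hx : f x ∈ radical K M) : x ∈ radical K L := by
  let I : LieIdeal K L := (radical K M).comap f
  let g : I →ₗ⁅K⁆ radical K M :=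
    { ((f : L →ₗ[K] M).comp I.toSubmodule.subtype).codRestrict (radical K M).toSubmodule
        fun v => LieIdeal.mem_comap.mp v.2 with
      map_lie' := by
        intro u v
        exact Subtype.ext (f.map_lie u v) }
  have hg : Function.Injective g := fun u v huv => Subtype.ext (hf (congrArg Subtype.val huv))
  have hI : IsSolvable I := hg.lieAlgebra_isSolvable
  exact (le_sSup hI : I ≤ radical K L) (LieIdeal.mem_comap.mpr hx)

end LieAlgebra

/-- The radical of an ideal is contained in the radical of the ambient Lie algebra. -/
theorem LieSubalgebra.IsIdealOf.mem_radical {K : Type*} [Field K] [CharZero K] {g : Type*}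
    [LieRing g] [LieAlgebra K g] [FiniteDimensional K g] {a b : LieSubalgebra K g}
    (hab : a.IsIdealOf b) {x : g} (hxa : x ∈ a)
    (hx : (⟨x, hxa⟩ : a) ∈ LieAlgebra.radical K a) :
    (⟨x, hab.1 hxa⟩ : b) ∈ LieAlgebra.radical K b :=
  LieAlgebra.map_mem_radical (LieSubalgebra.inclusion hab.1)
    (fun u v => ⟨⟨⁅(u : g), (v : g)⁆, hab.2 u u.2 v v.2⟩, rfl⟩) hx

/-- Schenkman: if `h` is a subideal of a finite-dimensional Lie algebra `g` over a field of
characteristic zero, then the radical of `h`, viewed inside `g`, equals `r_g ∩ h`. -/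
theorem radical_of_subideal {K : Type*} [Field K] [CharZero K] {g : Type*} [LieRing g]
    [LieAlgebra K g] [FiniteDimensional K g] (h : LieSubalgebra K g)
    (n : ℕ) (l : Fin (n + 1) → LieSubalgebra K g)
    (hl0 : l 0 = h) (hln : l (Fin.last n) = ⊤)
    (hchain : ∀ i : Fin n, (l i.castSucc).IsIdealOf (l i.succ)) :
    Submodule.map h.toSubmodule.subtype
        (LieSubmodule.toSubmodule (LieAlgebra.radical K h)) =
      LieSubmodule.toSubmodule (LieAlgebra.radical K g) ⊓ h.toSubmodule := by
  have key (i : Fin (n + 1)) : ∀ x (hx : x ∈ l 0), ⟨x, hx⟩ ∈ LieAlgebra.radical K (l 0) →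
      ∃ hxi : x ∈ l i, ⟨x, hxi⟩ ∈ LieAlgebra.radical K (l i) := by
    induction i using Fin.induction with
    | zero => exact fun x hx hxr => ⟨hx, hxr⟩
    | succ i ih =>
      intro x hx hxr
      obtain ⟨hxi, hxir⟩ := ih x hx hxr
      exact ⟨(hchain i).1 hxi, (hchain i).mem_radical hxi hxir⟩
  subst hl0
  ext x
  constructor
  · rintro ⟨⟨x, hx⟩, hxr, rfl⟩
    obtain ⟨hxn, hxnr⟩ := key (Fin.last n) x hx hxr
    refine ⟨?_, hx⟩
    refine LieAlgebra.map_mem_radical (l (Fin.last n)).incl (fun u v => ?_) hxnr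
    exact ⟨⟨⁅u, (v : g)⁆, by simp [hln]⟩, rfl⟩
  · rintro ⟨hxr, hx⟩
    exact ⟨⟨x, hx⟩, LieAlgebra.mem_radical_of_map_mem (l 0).incl Subtype.val_injective hxr, rfl⟩
end

section
/- Let g be a finite-dimensional Lie algebra over a field of characteristic zero and let h be a Lie subalgebra of g containing the radical of g. Then h is a subideal of g (there is a finite chain h = l₀ ⊴ l₁ ⊴ ⋯ ⊴ lₙ = g of subalgebras, each an ideal of the next) if and only if h is an ideal of g (⁅g, h⁆ ⊆ h). -/
/-- `a` is a subideal of `b`: there is a finite chain of Lie subalgebras from `a` to `b`,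
each an ideal of the next. -/
def LieSubalgebra.IsSubidealOf {K : Type*} [Field K] {g : Type*} [LieRing g] [LieAlgebra K g]
    (a b : LieSubalgebra K g) : Prop :=
  ∃ (n : ℕ) (l : Fin (n + 1) → LieSubalgebra K g), l 0 = a ∧ l (Fin.last n) = b ∧
    ∀ i : Fin n, (l i.castSucc).IsIdealOf (l i.succ)

namespace LieAlgebra

section Radical

variable {R L : Type*} [CommRing R] [LieRing L] [LieAlgebra R L]

/-- The quotient map by a Lie ideal, as a morphism of Lie algebras. -/
def quotientMkHom (I : LieIdeal R L) : L →ₗ⁅R⁆ L ⧸ I where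
  toLinearMap := (LieSubmodule.Quotient.mk' I : L →ₗ[R] L ⧸ I)
  map_lie' {x y} := LieSubmodule.Quotient.mk_bracket I x y

lemma quotientMkHom_surjective (I : LieIdeal R L) : Function.Surjective (quotientMkHom I) :=
  LieSubmodule.Quotient.surjective_mk' I

lemma quotientMkHom_eq_zero {I : LieIdeal R L} {x : L} : quotientMkHom I x = 0 ↔ x ∈ I :=
  LieSubmodule.Quotient.mk_eq_zero I

/-- An ideal is solvable as soon as its derived ideal is contained in a solvable ideal. -/
lemma isSolvable_of_lie_le {I J : LieIdeal R L} [IsSolvable J] (h : ⁅I, I⁆ ≤ J) :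
    IsSolvable I := by
  obtain ⟨k, hk⟩ := IsSolvable.solvable R J
  rw [LieIdeal.derivedSeries_eq_bot_iff] at hk
  refine IsSolvable.mk (R := R) (k := k + 1) ?_
  rw [LieIdeal.derivedSeries_eq_bot_iff, derivedSeriesOfIdeal_add, eq_bot_iff, ← hk]
  exact derivedSeriesOfIdeal_mono (by simpa using h) k

instance hasTrivialRadical_quotient_radical_s10 [IsNoetherian R L] :
    HasTrivialRadical R (L ⧸ radical R L) := by
  rw [hasTrivialRadical_iff_no_abelian_ideals]
  intro J hJ
  have hlie : ⁅J.comap (quotientMkHom (radical R L)), J.comap (quotientMkHom (radical R L))⁆ ≤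
      radical R L := by
    rw [LieSubmodule.lieIdeal_oper_eq_span, LieSubmodule.lieSpan_le]
    rintro _ ⟨⟨x, hx⟩, ⟨y, hy⟩, rfl⟩
    rw [LieIdeal.mem_comap] at hx hy
    refine quotientMkHom_eq_zero.mp ?_
    rw [LieHom.map_lie]
    exact congrArg Subtype.val (hJ.trivial (⟨_, hx⟩ : J) (⟨_, hy⟩ : J))
  have hle := (LieIdeal.solvable_iff_le_radical R L _).mp (isSolvable_of_lie_le hlie)
  rw [eq_bot_iff]
  intro z hz
  obtain ⟨x, rfl⟩ := quotientMkHom_surjective _ z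
  exact quotientMkHom_eq_zero.mpr (hle (LieIdeal.mem_comap.mpr hz))

end Radical

variable {K g : Type*} [Field K] [CharZero K] [LieRing g] [LieAlgebra K g] [FiniteDimensional K g]

/-- Modulo the radical, an ideal has a complement commuting with it. -/
lemma exists_sub_mem_forall_lie_mem_radical (I : LieIdeal K g) (x : g) :
    ∃ u ∈ I, ∀ y ∈ I, ⁅x - u, y⁆ ∈ radical K g := by
  let π := quotientMkHom (radical K g)
  have hπ : Function.Surjective π := quotientMkHom_surjective _
  have hc := LieIdeal.isCompl_killingCompl (I.map π)
  have hx : π x ∈ I.map π ⊔ (I.map π).killingCompl := by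
    rw [hc.sup_eq_top]; exact LieSubmodule.mem_top _
  obtain ⟨v, hv, w, hw, hvw⟩ := LieSubmodule.mem_sup _ _ _ |>.mp hx
  obtain ⟨⟨u, hu⟩, rfl⟩ := LieIdeal.mem_map_of_surjective hπ hv
  refine ⟨u, hu, fun y hy ↦ quotientMkHom_eq_zero.mp ?_⟩
  change π ⁅x - u, y⁆ = 0
  have hxu : π (x - u) = w := by rw [map_sub, ← hvw, add_sub_cancel_left]
  rw [LieHom.map_lie, hxu, ← LieSubmodule.mem_bot (R := K) (L := g ⧸ radical K g),
    ← hc.inf_eq_bot]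
  exact ⟨lie_mem_right K _ _ _ _ (LieIdeal.mem_map hy), lie_mem_left K _ _ _ _ hw⟩

end LieAlgebra

/-- An ideal of an ideal is an ideal, provided that it contains the radical. -/
lemma LieSubalgebra.IsIdealOf.lie_mem_of_radical_le {K g : Type*} [Field K] [CharZero K]
    [LieRing g] [LieAlgebra K g] [FiniteDimensional K g] {a b : LieSubalgebra K g}
    (hab : a.IsIdealOf b) (hb : ∀ x : g, ∀ y ∈ b, ⁅x, y⁆ ∈ b)
    (hrad : ∀ x ∈ LieAlgebra.radical K g, x ∈ a) (x : g) {y : g} (hy : y ∈ a) : ⁅x, y⁆ ∈ a := by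
  obtain ⟨I, rfl⟩ := (LieSubalgebra.exists_lieIdeal_coe_eq_iff K b).mpr fun x y ↦ hb x y
  obtain ⟨u, hu, hxu⟩ := LieAlgebra.exists_sub_mem_forall_lie_mem_radical I x
  rw [← sub_add_cancel x u, add_lie]
  exact add_mem (hrad _ (hxu y (hab.1 hy))) (hab.2 u hu y hy)

/-- If a Lie subalgebra `h` of a finite-dimensional Lie algebra `g` over a field of
characteristic zero contains the radical of `g`, then `h` is a subideal of `g` iff `h` is an
ideal of `g`. -/
theorem subideal_iff_ideal_of_radical_le {K : Type*} [Field K] [CharZero K] {g : Type*}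
    [LieRing g] [LieAlgebra K g] [FiniteDimensional K g] (h : LieSubalgebra K g)
    (hrad : ∀ x : g, x ∈ LieAlgebra.radical K g → x ∈ h) :
    h.IsSubidealOf ⊤ ↔ ∀ x : g, ∀ y ∈ h, ⁅x, y⁆ ∈ h := by
  constructor
  · rintro ⟨n, l, rfl, htop, hl⟩
    have hmono : Monotone l := Fin.monotone_iff_le_succ.mpr fun i ↦ (hl i).1
    suffices ∀ i, ∀ x : g, ∀ y ∈ l i, ⁅x, y⁆ ∈ l i from this 0
    intro i
    induction i using Fin.reverseInduction with
    | last => simp [htop]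
    | cast i ih =>
      exact fun x y hy ↦ (hl i).lie_mem_of_radical_le ih
        (fun z hz ↦ hmono (Fin.zero_le _) (hrad z hz)) x hy
  · intro hh
    exact ⟨1, ![h, ⊤], rfl, rfl, fun i ↦ by
      fin_cases i
      exact ⟨le_top, fun x _ y hy ↦ hh x y hy⟩⟩
end

section
/- Let g be a finite-dimensional reductive Lie algebra over a field of characteristic zero, i.e. the radical of g equals the center of g. Then any Lie subalgebra h of g is a subideal of g (there is a finite chain h = l₀ ⊴ l₁ ⊴ ⋯ ⊴ lₙ = g of subalgebras, each an ideal of the next) if and only if h is an ideal of g (⁅g, h⁆ ⊆ h). -/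
namespace LieAlgebra

variable {K L L' : Type*} [Field K] [LieRing L] [LieAlgebra K L] [LieRing L'] [LieAlgebra K L']

/-- The quotient of a Lie algebra by its radical has trivial radical. -/
theorem hasTrivialRadical_of_surjective_of_ker_eq_radical [FiniteDimensional K L]
    (f : L →ₗ⁅K⁆ L') (hf : Function.Surjective f) (hker : f.ker = radical K L) :
    HasTrivialRadical K L' := by
  rw [hasTrivialRadical_iff_no_abelian_ideals]
  intro I hI
  rw [LieSubmodule.lie_abelian_iff_lie_self_eq_bot] at hI
  have hle : ⁅I.comap f, I.comap f⁆ ≤ radical K L := by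
    rw [← hker]
    exact (LieIdeal.comap_bracket_le f).trans (by rw [hI]; exact le_rfl)
  obtain ⟨k, hk⟩ := IsSolvable.solvable K (radical K L)
  rw [LieIdeal.derivedSeries_eq_bot_iff] at hk
  have hsol : IsSolvable (I.comap f) := by
    refine IsSolvable.mk (R := K) (k := k + 1) ((LieIdeal.derivedSeries_eq_bot_iff _ _).mpr ?_)
    rw [derivedSeriesOfIdeal_add, derivedSeriesOfIdeal_succ, derivedSeriesOfIdeal_zero,
      eq_bot_iff, ← hk]
    exact derivedSeriesOfIdeal_le hle le_rfl
  rw [LieIdeal.solvable_iff_le_radical, ← hker] at hsol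
  rw [eq_bot_iff]
  intro y hy
  obtain ⟨x, rfl⟩ := hf y
  exact LieHom.mem_ker.mp (hsol (LieIdeal.mem_comap.mpr hy))

/-- Ideals of a Lie algebra with non-degenerate Killing form are perfect. -/
theorem IsKilling.lie_self_eq [IsKilling K L] [FiniteDimensional K L] (I : LieIdeal K L) :
    ⁅I, I⁆ = I := by
  set J : LieIdeal K L := ⁅I, I⁆ with hJ
  have hJI : J ≤ I := LieSubmodule.lie_le_left _ _
  have hc := LieIdeal.isCompl_killingCompl J
  have hbot : I ⊓ J.killingCompl K L = ⊥ := by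
    refine HasTrivialRadical.eq_bot_of_isSolvable (R := K) _ (hI := ?_)
    have : IsLieAbelian (I ⊓ J.killingCompl K L : LieIdeal K L) := by
      rw [LieSubmodule.lie_abelian_iff_lie_self_eq_bot, eq_bot_iff, ← hc.inf_eq_bot]
      exact le_inf (LieSubmodule.mono_lie inf_le_left inf_le_left)
        ((LieSubmodule.lie_le_left _ _).trans inf_le_right)
    infer_instance
  calc J = J ⊔ (J.killingCompl K L ⊓ I) := by rw [inf_comm, hbot, sup_bot_eq]
    _ = (J ⊔ J.killingCompl K L) ⊓ I := (sup_inf_assoc_of_le _ hJI).symm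
    _ = I := by rw [hc.sup_eq_top, top_inf_eq]

attribute [local instance] LieRing.ofAssociativeRing

/-- A reductive Lie algebra in characteristic zero is the sum of any ideal and its centralizer. -/
theorem exists_mem_forall_lie_sub_eq_zero [CharZero K] [FiniteDimensional K L]
    (hred : radical K L = center K L) (I : LieIdeal K L) (x : L) :
    ∃ y ∈ I, ∀ z ∈ I, ⁅x - y, z⁆ = 0 := by
  let f := (ad K L).rangeRestrict
  have hf : Function.Surjective f := (ad K L).surjective_rangeRestrict
  have hmem (z : L) : f z = 0 ↔ z ∈ center K L := by
    rw [← self_module_ker_eq_center, ← ad_ker_eq_self_module_ker, LieHom.mem_ker]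
    exact Subtype.ext_iff
  have hker : f.ker = center K L := by
    ext z
    rw [LieHom.mem_ker, hmem]
  have : HasTrivialRadical K (ad K L).range :=
    hasTrivialRadical_of_surjective_of_ker_eq_radical f hf (hker.trans hred.symm)
  set J := I.map f
  have hc := LieIdeal.isCompl_killingCompl J
  have hx : f x ∈ J ⊔ J.killingCompl K _ := by rw [hc.sup_eq_top]; trivial
  obtain ⟨u, hu, v, hv, huv⟩ := (LieSubmodule.mem_sup _ _ _).mp hx
  obtain ⟨⟨y, hy⟩, rfl⟩ := LieIdeal.mem_map_of_surjective hf hu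
  have hxy : f (x - y) ∈ J.killingCompl K _ := by
    rwa [map_sub, ← huv, add_sub_cancel_left]
  refine ⟨y, hy, ?_⟩
  have hcentral (z : L) (hz : z ∈ I) (w : L) : ⁅w, ⁅x - y, z⁆⁆ = 0 := by
    refine (LieModule.mem_maxTrivSubmodule K L L _).mp ((hmem _).mp ?_) w
    rw [LieHom.map_lie, ← LieSubmodule.mem_bot (R := K) (L := (ad K L).range), ← hc.inf_eq_bot]
    exact ⟨lie_mem_right K _ _ _ _ (LieIdeal.mem_map hz), lie_mem_left K _ _ _ _ hxy⟩
  have hderived (w : L) (hw : w ∈ ⁅I, I⁆) : ⁅x - y, w⁆ = 0 := by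
    rw [← LieSubmodule.mem_toSubmodule, LieSubmodule.lieIdeal_oper_eq_linear_span'] at hw
    induction hw using Submodule.span_induction with
    | mem w hw =>
      obtain ⟨a, ha, b, hb, rfl⟩ := hw
      rw [leibniz_lie, ← lie_skew, hcentral a ha, hcentral b hb, neg_zero, add_zero]
    | zero => exact lie_zero _
    | add a b _ _ ha hb => rw [lie_add, ha, hb, add_zero]
    | smul t a _ ha => rw [lie_smul, ha, smul_zero]
  intro z hz
  have hfz : f z ∈ ⁅I, I⁆.map f := by
    rw [LieIdeal.map_bracket_eq f hf, IsKilling.lie_self_eq]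
    exact LieIdeal.mem_map hz
  obtain ⟨⟨w, hw⟩, hwz⟩ := LieIdeal.mem_map_of_surjective hf hfz
  have hzw : z - w ∈ center K L := by rw [← hmem, map_sub, hwz, sub_self]
  rw [← sub_add_cancel z w, lie_add, hderived w hw, add_zero]
  exact (LieModule.mem_maxTrivSubmodule K L L _).mp hzw _

/-- In a reductive Lie algebra in characteristic zero, being an ideal is transitive. -/
theorem isIdealOf_top_trans [CharZero K] [FiniteDimensional K L]
    (hred : radical K L = center K L) {a b : LieSubalgebra K L}
    (hab : a.IsIdealOf b) (hb : b.IsIdealOf ⊤) : a.IsIdealOf ⊤ := by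
  refine ⟨le_top, fun x _ z hz ↦ ?_⟩
  let I : LieIdeal K L := { b.toSubmodule with lie_mem := fun {x m} hm ↦ hb.2 x trivial m hm }
  obtain ⟨y, hy, hxy⟩ := exists_mem_forall_lie_sub_eq_zero hred I x
  rw [← sub_add_cancel x y, add_lie, hxy z (hab.1 hz), zero_add]
  exact hab.2 y hy z hz

end LieAlgebra

/-- In a finite-dimensional reductive Lie algebra `g` (radical equals center) over a field of
characteristic zero, a Lie subalgebra `h` is a subideal of `g` iff it is an ideal of `g`. -/
theorem subideal_iff_ideal_of_reductive {K : Type*} [Field K] [CharZero K] {g : Type*}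
    [LieRing g] [LieAlgebra K g] [FiniteDimensional K g]
    (hred : LieAlgebra.radical K g = LieAlgebra.center K g)
    (h : LieSubalgebra K g) :
    h.IsSubidealOf ⊤ ↔ ∀ x : g, ∀ y ∈ h, ⁅x, y⁆ ∈ h := by
  constructor
  · rintro ⟨n, l, rfl, hn, hl⟩
    have hideal (i : Fin (n + 1)) : (l i).IsIdealOf ⊤ := by
      induction i using Fin.reverseInduction with
      | last => rw [hn]; exact ⟨le_rfl, fun _ _ _ _ ↦ trivial⟩
      | cast i ih => exact LieAlgebra.isIdealOf_top_trans hred (hl i) ih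
    exact fun x y hy ↦ (hideal 0).2 x trivial y hy
  · intro hh
    refine ⟨1, ![h, ⊤], rfl, rfl, fun i ↦ ?_⟩
    rw [Subsingleton.elim i 0]
    exact ⟨le_top, fun x _ y hy ↦ hh x y hy⟩
end

section
/- Let g be a finite-dimensional Lie algebra over a field of characteristic zero and let h be a Lie subalgebra of g whose radical is trivial (h is semisimple, i.e. its only solvable ideal is {0}). Then for any Lie subalgebra k of g containing h, h is a subideal of k (there is a finite chain h = l₀ ⊴ l₁ ⊴ ⋯ ⊴ lₙ = k of subalgebras of k, each an ideal of the next) if and only if h is an ideal of k (⁅k, h⁆ ⊆ h). -/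
/-- A finite-dimensional Lie algebra over a field with non-degenerate Killing form is perfect. -/
theorem LieAlgebra.IsKilling.lie_top_top_eq_top (K L : Type*) [Field K] [LieRing L]
    [LieAlgebra K L] [FiniteDimensional K L] [LieAlgebra.IsKilling K L] :
    ⁅(⊤ : LieIdeal K L), (⊤ : LieIdeal K L)⁆ = ⊤ := by
  set D : LieIdeal K L := ⁅(⊤ : LieIdeal K L), (⊤ : LieIdeal K L)⁆
  have hc : IsCompl D D.killingCompl := LieIdeal.isCompl_killingCompl D
  suffices hbot : D.killingCompl = ⊥ by simpa [hbot] using hc.sup_eq_top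
  rw [eq_bot_iff, ← LieAlgebra.center_eq_bot K L]
  intro z hz
  rw [LieModule.mem_maxTrivSubmodule]
  intro x
  have hxD : ⁅x, z⁆ ∈ D :=
    LieSubmodule.lie_mem_lie (LieSubmodule.mem_top x) (LieSubmodule.mem_top z)
  have hxC : ⁅x, z⁆ ∈ D.killingCompl := lie_mem_right K L _ x z hz
  have hx : ⁅x, z⁆ ∈ D ⊓ D.killingCompl := ⟨hxD, hxC⟩
  rwa [hc.inf_eq_bot, LieSubmodule.mem_bot] at hx

/-- A perfect ideal of an ideal `a` of `b` is stable under bracketing with `b`. -/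
theorem LieSubalgebra.lie_mem_of_perfect {K : Type*} [Field K] {g : Type*} [LieRing g]
    [LieAlgebra K g] {h a b : LieSubalgebra K g}
    (hperf : ⁅(⊤ : LieIdeal K h), (⊤ : LieIdeal K h)⁆ = ⊤) (hle : h ≤ a)
    (hideal : ∀ x ∈ a, ∀ y ∈ h, ⁅x, y⁆ ∈ h) (hab : a.IsIdealOf b) :
    ∀ x ∈ b, ∀ y ∈ h, ⁅x, y⁆ ∈ h := by
  intro x hx y hy
  have hspan : (⟨y, hy⟩ : h) ∈
      Submodule.span K {⁅u, v⁆ | (u ∈ (⊤ : LieIdeal K h)) (v ∈ (⊤ : LieIdeal K h))} := by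
    rw [← LieSubmodule.lieIdeal_oper_eq_linear_span', hperf]
    exact LieSubmodule.mem_top _
  suffices ∀ w ∈ Submodule.span K
      {⁅u, v⁆ | (u ∈ (⊤ : LieIdeal K h)) (v ∈ (⊤ : LieIdeal K h))}, ⁅x, (w : g)⁆ ∈ h from
    this _ hspan
  intro w hw
  induction hw using Submodule.span_induction with
  | mem w hw =>
    obtain ⟨u, -, v, -, rfl⟩ := hw
    rw [LieSubalgebra.coe_bracket, leibniz_lie]
    refine h.add_mem (hideal _ (hab.2 x hx _ (hle u.2)) _ v.2) ?_
    rw [← lie_skew]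
    exact h.neg_mem (hideal _ (hab.2 x hx _ (hle v.2)) _ u.2)
  | zero => simp
  | add u v _ _ hu hv => simpa using h.add_mem hu hv
  | smul c u _ hu => simpa using h.smul_mem c hu

/-- If a Lie subalgebra `h` of a finite-dimensional Lie algebra `g` in characteristic zero has
trivial radical (i.e. `h` is semisimple), then for any Lie subalgebra `k` of `g` containing
`h`, the algebra `h` is a subideal of `k` iff it is an ideal of `k`. -/
theorem subideal_iff_ideal_of_semisimple {K : Type*} [Field K] [CharZero K] {g : Type*}
    [LieRing g] [LieAlgebra K g] [FiniteDimensional K g] (h : LieSubalgebra K g)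
    (hrad : LieAlgebra.radical K h = ⊥) :
    ∀ k : LieSubalgebra K g, h ≤ k →
      (h.IsSubidealOf k ↔ ∀ x ∈ k, ∀ y ∈ h, ⁅x, y⁆ ∈ h) := by
  intro k hk
  refine ⟨?_, fun hideal ↦ ⟨1, ![h, k], rfl, rfl, fun i ↦ ?_⟩⟩
  · rintro ⟨n, l, rfl, rfl, hl⟩
    have : LieAlgebra.HasTrivialRadical K (l 0) := ⟨hrad⟩
    have hperf := LieAlgebra.IsKilling.lie_top_top_eq_top K (l 0)
    have key : ∀ i, l 0 ≤ l i ∧ ∀ x ∈ l i, ∀ y ∈ l 0, ⁅x, y⁆ ∈ l 0 := by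
      intro i
      induction i using Fin.induction with
      | zero => exact ⟨le_rfl, fun x hx y hy ↦ (l 0).lie_mem hx hy⟩
      | succ i ih =>
        exact ⟨ih.1.trans (hl i).1, LieSubalgebra.lie_mem_of_perfect hperf ih.1 ih.2 (hl i)⟩
    exact (key _).2
  · fin_cases i
    exact ⟨hk, hideal⟩
end

section
/- Let g be a finite-dimensional Lie algebra over a field of characteristic zero and let h be a Lie subalgebra of g whose radical (viewed as a subspace of g) is contained in the center of g. Then the normalizer N_g(h) of h in g is a self-normalizing subalgebra of g: N_g(N_g(h)) = N_g(h). -/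
namespace LieAlgebra

variable {K L : Type*} [Field K] [LieRing L] [LieAlgebra K L] [FiniteDimensional K L]

/-- An element that brackets everything into a central radical lies in the radical. -/
theorem normalizer_radical_le_of_radical_le_center (hc : radical K L ≤ center K L) :
    (radical K L).normalizer ≤ radical K L := by
  set J : LieIdeal K L := (radical K L).normalizer with hJ
  have h1 : ⁅J, J⁆ ≤ center K L := by
    refine (LieSubmodule.lie_le_iff _ _ _).mpr fun x _ y hy => hc ?_
    exact (LieSubmodule.mem_normalizer _ y).mp hy x
  have h2 : ⁅⁅J, J⁆, ⁅J, J⁆⁆ = (⊥ : LieIdeal K L) := by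
    refine eq_bot_iff.mpr ((LieSubmodule.lie_le_iff _ _ _).mpr fun x _ y hy => ?_)
    exact (LieSubmodule.mem_bot _).mpr ((LieModule.mem_maxTrivSubmodule K L L y).mp (h1 hy) x)
  rw [← LieIdeal.solvable_iff_le_radical, isSolvable_iff K]
  refine ⟨2, ?_⟩
  rw [LieIdeal.derivedSeries_eq_bot_iff]
  exact h2

variable [CharZero K]

/-- Over a field of characteristic zero, a Lie algebra with central radical is the sum of its
derived subalgebra and its radical. -/
theorem lie_top_sup_radical_eq_top (hc : radical K L ≤ center K L) :
    ⁅(⊤ : LieIdeal K L), (⊤ : LieIdeal K L)⁆ ⊔ radical K L = ⊤ := by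
  set W : LieIdeal K L := ⁅(⊤ : LieIdeal K L), (⊤ : LieIdeal K L)⁆ ⊔ radical K L
  set B : LinearMap.BilinForm K L := killingForm K L
  have hrefl : B.IsRefl := (LieModule.traceForm_isSymm K L L).isRefl
  have hker : B.orthogonal ⊤ ≤ (radical K L).toSubmodule := fun x hx =>
    killingCompl_top_le_radical K L ((LieIdeal.mem_killingCompl K L ⊤).mpr fun y _ => hx y trivial)
  have hrad : (radical K L).toSubmodule ≤ B.orthogonal ⊤ := by
    intro x hx y _
    have hx0 : ad K L x = 0 := by
      ext z
      have := (LieModule.mem_maxTrivSubmodule K L L x).mp (hc hx) z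
      rw [ad_apply, ← lie_skew, this, neg_zero, LinearMap.zero_apply]
    change killingForm K L y x = 0
    simp [killingForm_apply_apply, hx0]
  have horth : B.orthogonal W.toSubmodule ≤ B.orthogonal ⊤ := by
    intro x hx
    refine hrad (normalizer_radical_le_of_radical_le_center hc ?_)
    refine (LieSubmodule.mem_normalizer _ x).mpr fun y => hker fun z _ => ?_
    have hzy : ⁅z, y⁆ ∈ W := LieSubmodule.mem_sup_left
      (LieSubmodule.lie_mem_lie (LieSubmodule.mem_top z) (LieSubmodule.mem_top y))
    change killingForm K L z ⁅y, x⁆ = 0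
    rw [← LieModule.traceForm_apply_lie_apply]
    exact hx _ hzy
  have hle : B.orthogonal ⊤ ≤ W.toSubmodule := hker.trans (le_sup_right : radical K L ≤ W)
  have hdim := LinearMap.BilinForm.finrank_add_finrank_orthogonal hrefl W.toSubmodule
  rw [inf_eq_right.mpr hle] at hdim
  have hmono := Submodule.finrank_mono horth
  rw [← LieSubmodule.toSubmodule_eq_top]
  exact Submodule.eq_top_of_finrank_eq (le_antisymm (Submodule.finrank_le _) (by omega))

end LieAlgebra

/-- If the radical of a Lie subalgebra `h` of a finite-dimensional Lie algebra `g` over a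
field of characteristic zero is contained in the center of `g`, then the normalizer of `h` in
`g` is a self-normalizing subalgebra of `g`. -/
theorem normalizer_self_normalizing_of_radical_central {K : Type*} [Field K] [CharZero K]
    {g : Type*} [LieRing g] [LieAlgebra K g] [FiniteDimensional K g] (h : LieSubalgebra K g)
    (hrad : ∀ x : h, x ∈ LieAlgebra.radical K h → (x : g) ∈ LieAlgebra.center K g) :
    h.normalizer.normalizer = h.normalizer := by
  have hc : LieAlgebra.radical K h ≤ LieAlgebra.center K h := fun x hx =>
    (LieModule.mem_maxTrivSubmodule K h h x).mpr fun y =>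
      Subtype.ext ((LieModule.mem_maxTrivSubmodule K g g x).mp (hrad x hx) y)
  refine le_antisymm (fun X hX => ?_) h.normalizer.le_normalizer
  let S : Submodule K h := h.toSubmodule.comap ((LieAlgebra.ad K g X) ∘ₗ h.toSubmodule.subtype)
  have hD : (⁅(⊤ : LieIdeal K h), (⊤ : LieIdeal K h)⁆ : LieIdeal K h).toSubmodule ≤ S := by
    rw [LieSubmodule.lieIdeal_oper_eq_linear_span', Submodule.span_le]
    rintro _ ⟨a, -, b, -, rfl⟩
    have hXn : ∀ c : h, ⁅X, (c : g)⁆ ∈ h.normalizer := fun c =>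
      h.normalizer.ideal_in_normalizer hX (h.le_normalizer c.2)
    change ⁅X, ⁅(a : g), (b : g)⁆⁆ ∈ h
    rw [leibniz_lie]
    exact h.add_mem (h.ideal_in_normalizer (hXn a) b.2)
      ((h.mem_normalizer_iff' _).mp (hXn b) a a.2)
  have hR : (LieAlgebra.radical K h).toSubmodule ≤ S := by
    intro x hx
    change ⁅X, (x : g)⁆ ∈ h
    rw [(LieModule.mem_maxTrivSubmodule K g g x).mp (hrad x hx) X]
    exact h.zero_mem
  have hS : (⊤ : Submodule K h) ≤ S := by
    rw [← LieSubmodule.top_toSubmodule (R := K) (L := h) (M := h),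
      ← LieAlgebra.lie_top_sup_radical_eq_top hc, LieSubmodule.sup_toSubmodule]
    exact sup_le hD hR
  exact (h.mem_normalizer_iff X).mpr fun y hy => hS (x := ⟨y, hy⟩) trivial
end

section
/- Let g be a finite-dimensional real Lie algebra and let h be a compactly embedded Lie subalgebra of g: there exists an inner product B on g (a positive-definite symmetric bilinear form) such that for every X ∈ h the operator ad_X is skew-symmetric with respect to B, i.e. B(⁅X, Y⁆, Z) + B(Y, ⁅X, Z⁆) = 0 for all Y, Z ∈ g. Then the normalizer N_g(h) of h in g is a self-normalizing subalgebra of g: N_g(N_g(h)) = N_g(h). -/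
/-- If `h` is a compactly embedded Lie subalgebra of a finite-dimensional real Lie algebra `g`
(there is an inner product `B` on `g` making every `ad_X`, `X ∈ h`, skew-symmetric), then the
normalizer of `h` in `g` is a self-normalizing subalgebra of `g`. -/
theorem normalizer_self_normalizing_of_compactly_embedded {g : Type*} [LieRing g]
    [LieAlgebra ℝ g] [FiniteDimensional ℝ g] (h : LieSubalgebra ℝ g)
    (hcompact : ∃ B : g →ₗ[ℝ] g →ₗ[ℝ] ℝ,
      (∀ X Y : g, B X Y = B Y X) ∧
      (∀ X : g, X ≠ 0 → 0 < B X X) ∧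
      (∀ X ∈ h, ∀ Y Z : g, B ⁅X, Y⁆ Z + B Y ⁅X, Z⁆ = 0)) :
    h.normalizer.normalizer = h.normalizer := by
  obtain ⟨B, hsymm, hpos, hskew⟩ := hcompact
  refine le_antisymm (fun X hX => ?_) h.normalizer.le_normalizer
  have hrefl : LinearMap.BilinForm.IsRefl B := fun x y hxy => by rw [hsymm, hxy]
  have hdisj : Disjoint h.normalizer.toSubmodule
      (LinearMap.BilinForm.orthogonal B h.normalizer.toSubmodule) := by
    rw [Submodule.disjoint_def]
    intro x hx hx'
    by_contra h0
    exact (hpos x h0).ne' (hx' x hx)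
  have hcompl := (LinearMap.BilinForm.isCompl_orthogonal_iff_disjoint hrefl).2 hdisj
  obtain ⟨n, hn, p, hp, rfl⟩ :=
    Submodule.mem_sup.1 (hcompl.sup_eq_top ▸ Submodule.mem_top (x := X))
  have hpN : p ∈ h.normalizer.normalizer := by
    simpa using sub_mem hX (h.normalizer.le_normalizer hn)
  refine add_mem hn ((h.mem_normalizer_iff' p).2 fun Y hY => ?_)
  have hYN : Y ∈ h.normalizer := h.le_normalizer hY
  have hYp : ⁅Y, p⁆ ∈ h.normalizer := (h.normalizer.mem_normalizer_iff' p).1 hpN Y hYN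
  have horth : B ⁅Y, ⁅Y, p⁆⁆ p = 0 := hp _ (h.normalizer.lie_mem hYN hYp)
  have hzero : ⁅Y, p⁆ = 0 := by
    by_contra h0
    refine (hpos _ h0).ne' ?_
    simpa [hsymm p, horth] using hskew Y hY p ⁅Y, p⁆
  exact hzero ▸ h.zero_mem
end
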